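/- Along any PID-PBC closed-loop solution, the function U(q, q̇, z₁) := k_e [ k_a H_a(q_u, q̇) + k_u H_u(q_u, q̇_u) ] + ½ y_dᵀ K_D y_d + ½ z₁ᵀ K_I z₁ satisfies d/dt U(q(t), q̇(t), z₁(t)) = − y_d(t)ᵀ K_P y_d(t) ≤ 0 for all t ≥ 0. -/

import Mathlib

open Matrix Set Filter

noncomputable section

/-- Componentwise gradient of a scalar function on `Fin k → ℝ`. -/
def grad {k : ℕ} (f : (Fin k → ℝ) → ℝ) (x : Fin k → ℝ) : Fin k → ℝ :=
  fun i => fderiv ℝ f x (Pi.single i 1)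

/-- The block inertia matrix `M(q_u) = [[m_uu, m_auᵀ], [m_au, m_aa]]`. -/
def Mblk {s m : ℕ} (muu : (Fin s → ℝ) → Matrix (Fin s) (Fin s) ℝ)
    (mau : (Fin s → ℝ) → Matrix (Fin m) (Fin s) ℝ)
    (maa : Matrix (Fin m) (Fin m) ℝ) (qu : Fin s → ℝ) :
    Matrix (Fin s ⊕ Fin m) (Fin s ⊕ Fin m) ℝ :=
  Matrix.fromBlocks (muu qu) (mau qu)ᵀ (mau qu) maa

/-- The Jacobian `J(q, v)` (w.r.t. `q`) of the map `q ↦ M(q_u) v`. -/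
def Jmat {s m : ℕ} (muu : (Fin s → ℝ) → Matrix (Fin s) (Fin s) ℝ)
    (mau : (Fin s → ℝ) → Matrix (Fin m) (Fin s) ℝ)
    (maa : Matrix (Fin m) (Fin m) ℝ)
    (q v : (Fin s ⊕ Fin m) → ℝ) :
    Matrix (Fin s ⊕ Fin m) (Fin s ⊕ Fin m) ℝ :=
  fun i j =>
    fderiv ℝ (fun p : (Fin s ⊕ Fin m) → ℝ =>
      (Mblk muu mau maa (p ∘ Sum.inl) *ᵥ v) i) q (Pi.single j 1)

/-- The Coriolis force vector `C(q, q̇) q̇ = [J(q,q̇) − ½ J(q,q̇)ᵀ] q̇`. -/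
def Cvec {s m : ℕ} (muu : (Fin s → ℝ) → Matrix (Fin s) (Fin s) ℝ)
    (mau : (Fin s → ℝ) → Matrix (Fin m) (Fin s) ℝ)
    (maa : Matrix (Fin m) (Fin m) ℝ)
    (q v : (Fin s ⊕ Fin m) → ℝ) : (Fin s ⊕ Fin m) → ℝ :=
  (Jmat muu mau maa q v - (1/2 : ℝ) • (Jmat muu mau maa q v)ᵀ) *ᵥ v

/-- The Schur complement `m_uu^s(q_u) = m_uu − m_auᵀ m_aa⁻¹ m_au`. -/
def muuS {s m : ℕ} (muu : (Fin s → ℝ) → Matrix (Fin s) (Fin s) ℝ)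
    (mau : (Fin s → ℝ) → Matrix (Fin m) (Fin s) ℝ)
    (maa : Matrix (Fin m) (Fin m) ℝ) (qu : Fin s → ℝ) : Matrix (Fin s) (Fin s) ℝ :=
  muu qu - (mau qu)ᵀ * maa⁻¹ * mau qu

/-- `M_a(q_u) = [[m_auᵀ m_aa⁻¹ m_au, m_auᵀ], [m_au, m_aa]]`. -/
def MaMat {s m : ℕ} (mau : (Fin s → ℝ) → Matrix (Fin m) (Fin s) ℝ)
    (maa : Matrix (Fin m) (Fin m) ℝ) (qu : Fin s → ℝ) :
    Matrix (Fin s ⊕ Fin m) (Fin s ⊕ Fin m) ℝ :=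
  Matrix.fromBlocks ((mau qu)ᵀ * maa⁻¹ * mau qu) (mau qu)ᵀ (mau qu) maa

/-- Storage function `H_u(q_u, q̇_u) = ½ q̇_uᵀ m_uu^s(q_u) q̇_u + V_u(q_u)`. -/
def Hu {s m : ℕ} (muu : (Fin s → ℝ) → Matrix (Fin s) (Fin s) ℝ)
    (mau : (Fin s → ℝ) → Matrix (Fin m) (Fin s) ℝ)
    (maa : Matrix (Fin m) (Fin m) ℝ) (Vu : (Fin s → ℝ) → ℝ)
    (qu vu : Fin s → ℝ) : ℝ :=
  (1/2 : ℝ) * (vu ⬝ᵥ muuS muu mau maa qu *ᵥ vu) + Vu qu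

/-- Storage function `H_a(q_u, q̇) = ½ q̇ᵀ M_a(q_u) q̇`. -/
def Ha {s m : ℕ} (mau : (Fin s → ℝ) → Matrix (Fin m) (Fin s) ℝ)
    (maa : Matrix (Fin m) (Fin m) ℝ) (qu : Fin s → ℝ)
    (qdot : (Fin s ⊕ Fin m) → ℝ) : ℝ :=
  (1/2 : ℝ) * (qdot ⬝ᵥ MaMat mau maa qu *ᵥ qdot)

/-- Passive output `y_u = −m_aa⁻¹ m_au(q_u) q̇_u`. -/
def yU {s m : ℕ} (mau : (Fin s → ℝ) → Matrix (Fin m) (Fin s) ℝ)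
    (maa : Matrix (Fin m) (Fin m) ℝ) (qu vu : Fin s → ℝ) : Fin m → ℝ :=
  -(maa⁻¹ *ᵥ (mau qu *ᵥ vu))

/-- Passive output `y_a = m_aa⁻¹ m_au(q_u) q̇_u + q̇_a`. -/
def yA {s m : ℕ} (mau : (Fin s → ℝ) → Matrix (Fin m) (Fin s) ℝ)
    (maa : Matrix (Fin m) (Fin m) ℝ) (qu vu : Fin s → ℝ) (va : Fin m → ℝ) : Fin m → ℝ :=
  maa⁻¹ *ᵥ (mau qu *ᵥ vu) + va

/-- The signal `y_d = k_a y_a + k_u y_u` along a trajectory. -/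
def ydSig {s m : ℕ} (mau : (Fin s → ℝ) → Matrix (Fin m) (Fin s) ℝ)
    (maa : Matrix (Fin m) (Fin m) ℝ) (ka ku : ℝ)
    (q qd : ℝ → (Fin s ⊕ Fin m) → ℝ) (t : ℝ) : Fin m → ℝ :=
  ka • yA mau maa (q t ∘ Sum.inl) (qd t ∘ Sum.inl) (qd t ∘ Sum.inr)
    + ku • yU mau maa (q t ∘ Sum.inl) (qd t ∘ Sum.inl)

/-- A PID-PBC closed-loop solution: a trajectory of the mechanical system together with
the integrator state `z₁` satisfying `ż₁ = y_d` and the PID relation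
`k_e u = −(K_P y_d + K_I z₁ + K_D ẏ_d)`, where `u = τ − ∇V_a(q_a)`. -/
structure Sol {s m : ℕ} (muu : (Fin s → ℝ) → Matrix (Fin s) (Fin s) ℝ)
    (mau : (Fin s → ℝ) → Matrix (Fin m) (Fin s) ℝ)
    (maa : Matrix (Fin m) (Fin m) ℝ)
    (Vu : (Fin s → ℝ) → ℝ) (Va : (Fin m → ℝ) → ℝ)
    (ke ka ku : ℝ) (KP KI KD : Matrix (Fin m) (Fin m) ℝ) where
  q : ℝ → (Fin s ⊕ Fin m) → ℝ
  qd : ℝ → (Fin s ⊕ Fin m) → ℝ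
  qdd : ℝ → (Fin s ⊕ Fin m) → ℝ
  τ : ℝ → Fin m → ℝ
  z₁ : ℝ → Fin m → ℝ
  ydd : ℝ → Fin m → ℝ
  hτ : ContinuousOn τ (Ici 0)
  hq : ∀ t ∈ Ici (0:ℝ), HasDerivWithinAt q (qd t) (Ici 0) t
  hqd : ∀ t ∈ Ici (0:ℝ), HasDerivWithinAt qd (qdd t) (Ici 0) t
  hqdd : ContinuousOn qdd (Ici 0)
  hEL : ∀ t ∈ Ici (0:ℝ),
    Mblk muu mau maa (q t ∘ Sum.inl) *ᵥ qdd t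
      + Cvec muu mau maa (q t) (qd t)
      + Sum.elim (grad Vu (q t ∘ Sum.inl)) (grad Va (q t ∘ Sum.inr))
    = Sum.elim (0 : Fin s → ℝ) (τ t)
  hz₁ : ∀ t ∈ Ici (0:ℝ), HasDerivWithinAt z₁ (ydSig mau maa ka ku q qd t) (Ici 0) t
  hydd : ∀ t ∈ Ici (0:ℝ), HasDerivWithinAt (ydSig mau maa ka ku q qd) (ydd t) (Ici 0) t
  hPID : ∀ t ∈ Ici (0:ℝ),
    ke • (τ t - grad Va (q t ∘ Sum.inr))
      = -(KP *ᵥ ydSig mau maa ka ku q qd t + KI *ᵥ z₁ t + KD *ᵥ ydd t)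

section Calculus

variable {ι κ : Type*} [Fintype ι] [Fintype κ] {S : Set ℝ} {t : ℝ}

theorem HasDerivWithinAt.dotProduct {f g : ℝ → ι → ℝ} {f' g' : ι → ℝ}
    (hf : HasDerivWithinAt f f' S t) (hg : HasDerivWithinAt g g' S t) :
    HasDerivWithinAt (fun r => f r ⬝ᵥ g r) (f' ⬝ᵥ g t + f t ⬝ᵥ g') S t := by
  rw [hasDerivWithinAt_pi] at hf hg
  simp only [_root_.dotProduct, ← Finset.sum_add_distrib]
  exact HasDerivWithinAt.fun_sum fun i _ => (hf i).mul (hg i)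

theorem HasDerivWithinAt.mulVec {ι : Type*} {A : ℝ → Matrix ι κ ℝ} {A' : Matrix ι κ ℝ}
    {v : ℝ → κ → ℝ} {v' : κ → ℝ}
    (hA : ∀ i j, HasDerivWithinAt (fun r => A r i j) (A' i j) S t)
    (hv : HasDerivWithinAt v v' S t) :
    HasDerivWithinAt (fun r => A r *ᵥ v r) (A' *ᵥ v t + A t *ᵥ v') S t := by
  rw [hasDerivWithinAt_pi] at hv ⊢
  intro i
  simp only [Matrix.mulVec, _root_.dotProduct, Pi.add_apply, ← Finset.sum_add_distrib]
  exact HasDerivWithinAt.fun_sum fun j _ => (hA i j).mul (hv j)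

theorem HasDerivWithinAt.const_mulVec {ι : Type*} (A : Matrix ι κ ℝ) {v : ℝ → κ → ℝ} {v' : κ → ℝ}
    (hv : HasDerivWithinAt v v' S t) :
    HasDerivWithinAt (fun r => A *ᵥ v r) (A *ᵥ v') S t := by
  have h := HasDerivWithinAt.mulVec (A := fun _ => A) (A' := 0)
    (fun i j => hasDerivWithinAt_const t S (A i j)) hv
  simpa using h

theorem Matrix.IsSymm.dotProduct_mulVec_comm {A : Matrix ι ι ℝ} (hA : A.IsSymm) (v w : ι → ℝ) :
    v ⬝ᵥ A *ᵥ w = w ⬝ᵥ A *ᵥ v := by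
  rw [Matrix.dotProduct_mulVec, ← Matrix.mulVec_transpose, hA.eq, dotProduct_comm]

theorem HasDerivWithinAt.half_quadraticForm {A : Matrix ι ι ℝ} (hA : A.IsSymm)
    {v : ℝ → ι → ℝ} {v' : ι → ℝ} (hv : HasDerivWithinAt v v' S t) :
    HasDerivWithinAt (fun r => (1/2 : ℝ) * (v r ⬝ᵥ A *ᵥ v r)) (v t ⬝ᵥ A *ᵥ v') S t := by
  refine ((hv.dotProduct (hv.const_mulVec A)).const_mul (1/2 : ℝ)).congr_deriv ?_
  rw [hA.dotProduct_mulVec_comm v']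
  ring

theorem ContinuousLinearMap.sum_apply_single_mul [DecidableEq ι] (L : (ι → ℝ) →L[ℝ] ℝ)
    (v : ι → ℝ) : ∑ j, L (Pi.single j 1) * v j = L v := by
  conv_rhs => rw [pi_eq_sum_univ' v, map_sum]
  exact Finset.sum_congr rfl fun j _ => by rw [map_smul, smul_eq_mul, mul_comm]

theorem grad_dotProduct {k : ℕ} (f : (Fin k → ℝ) → ℝ) (x v : Fin k → ℝ) :
    grad f x ⬝ᵥ v = fderiv ℝ f x v :=
  ContinuousLinearMap.sum_apply_single_mul _ v

end Calculus

section Mechanics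

variable {s m : ℕ} {muu : (Fin s → ℝ) → Matrix (Fin s) (Fin s) ℝ}
  {mau : (Fin s → ℝ) → Matrix (Fin m) (Fin s) ℝ} {maa : Matrix (Fin m) (Fin m) ℝ}

/-- Precomposition with `Sum.inl`, the projection of configurations onto `q_u`. -/
def projU (s m : ℕ) : ((Fin s ⊕ Fin m) → ℝ) →L[ℝ] (Fin s → ℝ) :=
  ContinuousLinearMap.pi fun i => ContinuousLinearMap.proj (Sum.inl i)

theorem projU_apply (p : (Fin s ⊕ Fin m) → ℝ) : projU s m p = p ∘ Sum.inl := rfl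

/-- The directional derivative of the inertia matrix at `qu` along `w`. -/
def Mdot (muu : (Fin s → ℝ) → Matrix (Fin s) (Fin s) ℝ)
    (mau : (Fin s → ℝ) → Matrix (Fin m) (Fin s) ℝ) (maa : Matrix (Fin m) (Fin m) ℝ)
    (qu w : Fin s → ℝ) : Matrix (Fin s ⊕ Fin m) (Fin s ⊕ Fin m) ℝ :=
  fun i j => fderiv ℝ (fun x => Mblk muu mau maa x i j) qu w

theorem differentiable_Mblk (hmuu : ∀ i j, ContDiff ℝ (⊤ : ℕ∞) fun x => muu x i j)
    (hmau : ∀ i j, ContDiff ℝ (⊤ : ℕ∞) fun x => mau x i j) (i j : Fin s ⊕ Fin m) :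
    Differentiable ℝ fun x => Mblk muu mau maa x i j := by
  rcases i with i | i <;> rcases j with j | j
  · exact (hmuu i j).differentiable (by simp)
  · exact (hmau j i).differentiable (by simp)
  · exact (hmau i j).differentiable (by simp)
  · exact differentiable_const _

theorem hasFDerivAt_Mblk_mulVec
    (hd : ∀ i j, Differentiable ℝ fun x => Mblk muu mau maa x i j)
    (q v : (Fin s ⊕ Fin m) → ℝ) (i : Fin s ⊕ Fin m) :
    HasFDerivAt (fun p : (Fin s ⊕ Fin m) → ℝ => (Mblk muu mau maa (p ∘ Sum.inl) *ᵥ v) i)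
      (∑ j, v j • (fderiv ℝ (fun x => Mblk muu mau maa x i j) (q ∘ Sum.inl)).comp (projU s m))
      q := by
  simp only [Matrix.mulVec, _root_.dotProduct]
  refine HasFDerivAt.fun_sum fun j _ => HasFDerivAt.mul_const ?_ (v j)
  exact ((hd i j (q ∘ Sum.inl)).hasFDerivAt).comp q (projU s m).hasFDerivAt

theorem Jmat_mulVec (hd : ∀ i j, Differentiable ℝ fun x => Mblk muu mau maa x i j)
    (q v w : (Fin s ⊕ Fin m) → ℝ) :
    Jmat muu mau maa q v *ᵥ w = Mdot muu mau maa (q ∘ Sum.inl) (w ∘ Sum.inl) *ᵥ v := by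
  ext i
  have h : (Jmat muu mau maa q v *ᵥ w) i
      = fderiv ℝ (fun p : (Fin s ⊕ Fin m) → ℝ =>
          (Mblk muu mau maa (p ∘ Sum.inl) *ᵥ v) i) q w :=
    ContinuousLinearMap.sum_apply_single_mul _ w
  rw [h, (hasFDerivAt_Mblk_mulVec hd q v i).fderiv]
  simp [projU_apply, mul_comm, Matrix.mulVec, _root_.dotProduct, Mdot]

theorem Jmat_inr (hd : ∀ i j, Differentiable ℝ fun x => Mblk muu mau maa x i j)
    (q v : (Fin s ⊕ Fin m) → ℝ) (i : Fin s ⊕ Fin m) (j : Fin m) :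
    Jmat muu mau maa q v i (Sum.inr j) = 0 := by
  have h : (Pi.single (Sum.inr j) 1 : (Fin s ⊕ Fin m) → ℝ) ∘ Sum.inl = 0 := by
    ext k
    simp
  rw [Jmat, (hasFDerivAt_Mblk_mulVec hd q v i).fderiv]
  simp [projU_apply, h]

theorem Cvec_inr (hd : ∀ i j, Differentiable ℝ fun x => Mblk muu mau maa x i j)
    (q v : (Fin s ⊕ Fin m) → ℝ) (i : Fin m) :
    Cvec muu mau maa q v (Sum.inr i)
      = (Mdot muu mau maa (q ∘ Sum.inl) (v ∘ Sum.inl) *ᵥ v) (Sum.inr i) := by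
  have h : ((Jmat muu mau maa q v)ᵀ *ᵥ v) (Sum.inr i) = 0 := by
    simp [Matrix.mulVec, _root_.dotProduct, Jmat_inr hd]
  rw [Cvec, Matrix.sub_mulVec, Matrix.smul_mulVec, Jmat_mulVec hd]
  simp [h]

theorem dotProduct_Cvec (hd : ∀ i j, Differentiable ℝ fun x => Mblk muu mau maa x i j)
    (q v : (Fin s ⊕ Fin m) → ℝ) :
    v ⬝ᵥ Cvec muu mau maa q v
      = (1/2 : ℝ) * (v ⬝ᵥ Mdot muu mau maa (q ∘ Sum.inl) (v ∘ Sum.inl) *ᵥ v) := by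
  have h : v ⬝ᵥ (Jmat muu mau maa q v)ᵀ *ᵥ v = v ⬝ᵥ Jmat muu mau maa q v *ᵥ v := by
    rw [Matrix.mulVec_transpose, dotProduct_comm, ← Matrix.dotProduct_mulVec]
  rw [Cvec, Matrix.sub_mulVec, Matrix.smul_mulVec, dotProduct_sub, dotProduct_smul, h,
    Jmat_mulVec hd, smul_eq_mul]
  ring

theorem isUnit_det_maa {qu : Fin s → ℝ} (hM : (Mblk muu mau maa qu).PosDef) :
    IsUnit maa.det := by
  have h : (Mblk muu mau maa qu).submatrix Sum.inr Sum.inr = maa := by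
    ext i j
    rfl
  have hpos : maa.PosDef := h ▸ hM.submatrix Sum.inr_injective
  exact (Matrix.isUnit_iff_isUnit_det _).1 hpos.isUnit

/-- The actuated momentum `p_a = m_au(q_u) q̇_u + m_aa q̇_a`. -/
def momA (mau : (Fin s → ℝ) → Matrix (Fin m) (Fin s) ℝ) (maa : Matrix (Fin m) (Fin m) ℝ)
    (qu : Fin s → ℝ) (v : (Fin s ⊕ Fin m) → ℝ) : Fin m → ℝ :=
  mau qu *ᵥ (v ∘ Sum.inl) + maa *ᵥ (v ∘ Sum.inr)

theorem Mblk_mulVec_inr (qu : Fin s → ℝ) (v : (Fin s ⊕ Fin m) → ℝ) (i : Fin m) :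
    (Mblk muu mau maa qu *ᵥ v) (Sum.inr i) = momA mau maa qu v i := by
  simp [Mblk, momA, Matrix.fromBlocks_mulVec]

theorem yA_eq (hdet : IsUnit maa.det) (qu : Fin s → ℝ) (v : (Fin s ⊕ Fin m) → ℝ) :
    yA mau maa qu (v ∘ Sum.inl) (v ∘ Sum.inr) = maa⁻¹ *ᵥ momA mau maa qu v := by
  rw [yA, momA, Matrix.mulVec_add, Matrix.mulVec_mulVec (v ∘ Sum.inr),
    Matrix.nonsing_inv_mul _ hdet, Matrix.one_mulVec]

theorem yA_add_yU (qu vu : Fin s → ℝ) (va : Fin m → ℝ) :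
    yA mau maa qu vu va + yU mau maa qu vu = va := by
  rw [yA, yU]
  abel

theorem dotProduct_sumElim {a : Fin s → ℝ} {b : Fin m → ℝ} (v : (Fin s ⊕ Fin m) → ℝ) :
    v ⬝ᵥ Sum.elim a b = (v ∘ Sum.inl) ⬝ᵥ a + (v ∘ Sum.inr) ⬝ᵥ b := by
  simp [_root_.dotProduct]

theorem Ha_eq (hmaa : maa.IsSymm) (hdet : IsUnit maa.det) (qu : Fin s → ℝ)
    (v : (Fin s ⊕ Fin m) → ℝ) :
    Ha mau maa qu v = (1/2 : ℝ) * (momA mau maa qu v ⬝ᵥ maa⁻¹ *ᵥ momA mau maa qu v) := by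
  rw [← yA_eq hdet, Ha, MaMat, Matrix.fromBlocks_mulVec, dotProduct_sumElim, momA, yA]
  set a := mau qu *ᵥ (v ∘ Sum.inl) with ha
  set b := v ∘ Sum.inr
  have hT (w : Fin m → ℝ) : (v ∘ Sum.inl) ⬝ᵥ (mau qu)ᵀ *ᵥ w = a ⬝ᵥ w := by
    rw [Matrix.dotProduct_mulVec, Matrix.vecMul_transpose]
  have hc : maa *ᵥ b ⬝ᵥ maa⁻¹ *ᵥ a = b ⬝ᵥ a := by
    rw [dotProduct_comm, hmaa.dotProduct_mulVec_comm, Matrix.mulVec_mulVec,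
      Matrix.mul_nonsing_inv _ hdet, Matrix.one_mulVec]
  rw [← Matrix.mulVec_mulVec, ← Matrix.mulVec_mulVec, ← ha]
  simp only [dotProduct_add, add_dotProduct, hT, hc]
  rw [dotProduct_comm (maa *ᵥ b) b, dotProduct_comm b a]

theorem Ha_add_Hu (Vu : (Fin s → ℝ) → ℝ) (qu : Fin s → ℝ) (v : (Fin s ⊕ Fin m) → ℝ) :
    Ha mau maa qu v + Hu muu mau maa Vu qu (v ∘ Sum.inl)
      = (1/2 : ℝ) * (v ⬝ᵥ Mblk muu mau maa qu *ᵥ v) + Vu qu := by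
  rw [Ha, Hu, MaMat, Mblk, muuS, Matrix.fromBlocks_mulVec, Matrix.fromBlocks_mulVec,
    dotProduct_sumElim, dotProduct_sumElim, Matrix.sub_mulVec]
  simp only [dotProduct_add, dotProduct_sub]
  ring

section Trajectory

variable {Vu : (Fin s → ℝ) → ℝ} {gVa τ : Fin m → ℝ} {q qd : ℝ → (Fin s ⊕ Fin m) → ℝ}
  {qdd : (Fin s ⊕ Fin m) → ℝ} {S : Set ℝ} {t : ℝ}

theorem hasDerivWithinAt_Mblk_mulVec
    (hd : ∀ i j, Differentiable ℝ fun x => Mblk muu mau maa x i j)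
    (hq : HasDerivWithinAt q (qd t) S t) (hqd : HasDerivWithinAt qd qdd S t) :
    HasDerivWithinAt (fun r => Mblk muu mau maa (q r ∘ Sum.inl) *ᵥ qd r)
      (Mdot muu mau maa (q t ∘ Sum.inl) (qd t ∘ Sum.inl) *ᵥ qd t
        + Mblk muu mau maa (q t ∘ Sum.inl) *ᵥ qdd) S t := by
  refine HasDerivWithinAt.mulVec (fun i j => ?_) hqd
  exact (hd i j (q t ∘ Sum.inl)).hasFDerivAt.comp_hasDerivWithinAt t
    ((projU s m).hasFDerivAt.comp_hasDerivWithinAt t hq)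

/-- Along a trajectory the actuated momentum is driven by the inner-loop control. -/
theorem hasDerivWithinAt_momA
    (hd : ∀ i j, Differentiable ℝ fun x => Mblk muu mau maa x i j)
    (hq : HasDerivWithinAt q (qd t) S t) (hqd : HasDerivWithinAt qd qdd S t)
    (hEL : Mblk muu mau maa (q t ∘ Sum.inl) *ᵥ qdd + Cvec muu mau maa (q t) (qd t)
      + Sum.elim (grad Vu (q t ∘ Sum.inl)) gVa = Sum.elim (0 : Fin s → ℝ) τ) :
    HasDerivWithinAt (fun r => momA mau maa (q r ∘ Sum.inl) (qd r)) (τ - gVa) S t := by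
  have h := hasDerivWithinAt_pi.1 (hasDerivWithinAt_Mblk_mulVec hd hq hqd)
  refine hasDerivWithinAt_pi.2 fun i => ?_
  have hi := h (Sum.inr i)
  simp only [Mblk_mulVec_inr] at hi
  refine hi.congr_deriv ?_
  have hE := congrFun hEL (Sum.inr i)
  simp only [Pi.add_apply, Sum.elim_inr, Cvec_inr hd] at hE
  simp only [Pi.add_apply, Pi.sub_apply]
  linarith

/-- Power balance of the total inner-loop energy: its rate is `q̇_aᵀ u`. -/
theorem hasDerivWithinAt_energy
    (hd : ∀ i j, Differentiable ℝ fun x => Mblk muu mau maa x i j)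
    (hsymm : (Mblk muu mau maa (q t ∘ Sum.inl)).IsSymm) (hVu : Differentiable ℝ Vu)
    (hq : HasDerivWithinAt q (qd t) S t) (hqd : HasDerivWithinAt qd qdd S t)
    (hEL : Mblk muu mau maa (q t ∘ Sum.inl) *ᵥ qdd + Cvec muu mau maa (q t) (qd t)
      + Sum.elim (grad Vu (q t ∘ Sum.inl)) gVa = Sum.elim (0 : Fin s → ℝ) τ) :
    HasDerivWithinAt
      (fun r => (1/2 : ℝ) * (qd r ⬝ᵥ Mblk muu mau maa (q r ∘ Sum.inl) *ᵥ qd r)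
        + Vu (q r ∘ Sum.inl))
      ((qd t ∘ Sum.inr) ⬝ᵥ (τ - gVa)) S t := by
  have hK := (hqd.dotProduct (hasDerivWithinAt_Mblk_mulVec hd hq hqd)).const_mul (1/2 : ℝ)
  have hV : HasDerivWithinAt (fun r => Vu (q r ∘ Sum.inl))
      (fderiv ℝ Vu (q t ∘ Sum.inl) (qd t ∘ Sum.inl)) S t :=
    (hVu (q t ∘ Sum.inl)).hasFDerivAt.comp_hasDerivWithinAt t
      ((projU s m).hasFDerivAt.comp_hasDerivWithinAt t hq)
  refine (hK.add hV).congr_deriv ?_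
  have hE := congrArg (fun w => qd t ⬝ᵥ w) hEL
  simp only [dotProduct_add, dotProduct_Cvec hd, dotProduct_sumElim, dotProduct_zero] at hE
  rw [← grad_dotProduct, dotProduct_comm (grad Vu _), hsymm.dotProduct_mulVec_comm qdd,
    dotProduct_add, dotProduct_sub]
  linarith

/-- The map `u ↦ y_a` is passive and lossless with storage function `H_a`. -/
theorem hasDerivWithinAt_Ha
    (hd : ∀ i j, Differentiable ℝ fun x => Mblk muu mau maa x i j)
    (hmaa : maa.IsSymm) (hdet : IsUnit maa.det)
    (hq : HasDerivWithinAt q (qd t) S t) (hqd : HasDerivWithinAt qd qdd S t)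
    (hEL : Mblk muu mau maa (q t ∘ Sum.inl) *ᵥ qdd + Cvec muu mau maa (q t) (qd t)
      + Sum.elim (grad Vu (q t ∘ Sum.inl)) gVa = Sum.elim (0 : Fin s → ℝ) τ) :
    HasDerivWithinAt (fun r => Ha mau maa (q r ∘ Sum.inl) (qd r))
      (yA mau maa (q t ∘ Sum.inl) (qd t ∘ Sum.inl) (qd t ∘ Sum.inr) ⬝ᵥ (τ - gVa)) S t := by
  have hinv : maa⁻¹.IsSymm := by
    rw [Matrix.IsSymm, Matrix.transpose_nonsing_inv, hmaa.eq]
  simp only [Ha_eq hmaa hdet, yA_eq hdet]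
  refine (HasDerivWithinAt.half_quadraticForm hinv
    (hasDerivWithinAt_momA hd hq hqd hEL)).congr_deriv ?_
  rw [hinv.dotProduct_mulVec_comm, dotProduct_comm]

/-- The map `u ↦ y_u` is passive and lossless with storage function `H_u`. -/
theorem hasDerivWithinAt_Hu
    (hd : ∀ i j, Differentiable ℝ fun x => Mblk muu mau maa x i j)
    (hmaa : maa.IsSymm) (hdet : IsUnit maa.det)
    (hsymm : (Mblk muu mau maa (q t ∘ Sum.inl)).IsSymm) (hVu : Differentiable ℝ Vu)
    (hq : HasDerivWithinAt q (qd t) S t) (hqd : HasDerivWithinAt qd qdd S t)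
    (hEL : Mblk muu mau maa (q t ∘ Sum.inl) *ᵥ qdd + Cvec muu mau maa (q t) (qd t)
      + Sum.elim (grad Vu (q t ∘ Sum.inl)) gVa = Sum.elim (0 : Fin s → ℝ) τ) :
    HasDerivWithinAt (fun r => Hu muu mau maa Vu (q r ∘ Sum.inl) (qd r ∘ Sum.inl))
      (yU mau maa (q t ∘ Sum.inl) (qd t ∘ Sum.inl) ⬝ᵥ (τ - gVa)) S t := by
  have h := (hasDerivWithinAt_energy hd hsymm hVu hq hqd hEL).sub
    (hasDerivWithinAt_Ha hd hmaa hdet hq hqd hEL)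
  refine (h.congr_deriv ?_).congr_of_eventuallyEq (.of_forall fun r => ?_) ?_
  · rw [← sub_dotProduct]
    congr 1
    exact sub_eq_of_eq_add' (yA_add_yU _ _ _).symm
  · exact eq_sub_of_add_eq' (Ha_add_Hu _ _ _)
  · exact eq_sub_of_add_eq' (Ha_add_Hu _ _ _)

end Trajectory

end Mechanics

/-- along any PID-PBC closed-loop solution,
`d/dt U = −y_dᵀ K_P y_d ≤ 0` where
`U = k_e[k_a H_a + k_u H_u] + ½ y_dᵀ K_D y_d + ½ z₁ᵀ K_I z₁`. -/
theorem U_dissipation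
    {s m : ℕ} (hs : 1 ≤ s) (hm : 1 ≤ m)
    (muu : (Fin s → ℝ) → Matrix (Fin s) (Fin s) ℝ)
    (mau : (Fin s → ℝ) → Matrix (Fin m) (Fin s) ℝ)
    (maa : Matrix (Fin m) (Fin m) ℝ)
    (hmuu : ∀ i j, ContDiff ℝ (⊤ : ℕ∞) fun x => muu x i j)
    (hmau : ∀ i j, ContDiff ℝ (⊤ : ℕ∞) fun x => mau x i j)
    (hmaa : maa.IsSymm)
    (hM : ∀ qu, (Mblk muu mau maa qu).PosDef)
    (Vu : (Fin s → ℝ) → ℝ) (Va : (Fin m → ℝ) → ℝ)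
    (hVu : ContDiff ℝ (⊤ : ℕ∞) Vu) (hVa : ContDiff ℝ (⊤ : ℕ∞) Va)
    (ke ka ku : ℝ) (hke : ke ≠ 0) (hka : ka ≠ 0) (hku : ku ≠ 0) (hkaku : ka ≠ ku)
    (KP KI KD : Matrix (Fin m) (Fin m) ℝ)
    (hKP : KP.PosDef) (hKI : KI.PosDef) (hKD : KD.PosSemidef)
    (sol : Sol muu mau maa Vu Va ke ka ku KP KI KD) :
    ∀ t ∈ Ici (0:ℝ),
      HasDerivWithinAt
        (fun t => ke * (ka * Ha mau maa (sol.q t ∘ Sum.inl) (sol.qd t)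
            + ku * Hu muu mau maa Vu (sol.q t ∘ Sum.inl) (sol.qd t ∘ Sum.inl))
          + (1/2 : ℝ) * (ydSig mau maa ka ku sol.q sol.qd t ⬝ᵥ
              KD *ᵥ ydSig mau maa ka ku sol.q sol.qd t)
          + (1/2 : ℝ) * (sol.z₁ t ⬝ᵥ KI *ᵥ sol.z₁ t))
        (-(ydSig mau maa ka ku sol.q sol.qd t ⬝ᵥ
            KP *ᵥ ydSig mau maa ka ku sol.q sol.qd t))
        (Ici 0) t
      ∧ -(ydSig mau maa ka ku sol.q sol.qd t ⬝ᵥ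
          KP *ᵥ ydSig mau maa ka ku sol.q sol.qd t) ≤ 0 := by
  intro t ht
  have hd := differentiable_Mblk (maa := maa) hmuu hmau
  have hdet := isUnit_det_maa (hM 0)
  have hsymm : (Mblk muu mau maa (sol.q t ∘ Sum.inl)).IsSymm := by
    simpa using (hM (sol.q t ∘ Sum.inl)).isHermitian
  have hKDs : KD.IsSymm := by simpa using hKD.isHermitian
  have hKIs : KI.IsSymm := by simpa using hKI.isHermitian
  have hq := sol.hq t ht
  have hqd := sol.hqd t ht
  have hEL := sol.hEL t ht
  refine ⟨?_, ?_⟩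
  · have hA := hasDerivWithinAt_Ha hd hmaa hdet hq hqd hEL
    have hU := hasDerivWithinAt_Hu hd hmaa hdet hsymm (hVu.differentiable (by simp)) hq hqd hEL
    have hD := HasDerivWithinAt.half_quadraticForm hKDs (sol.hydd t ht)
    have hI := HasDerivWithinAt.half_quadraticForm hKIs (sol.hz₁ t ht)
    refine (((((hA.const_mul ka).add (hU.const_mul ku)).const_mul ke).add hD).add
      hI).congr_deriv ?_
    have hP := congrArg (fun w => ydSig mau maa ka ku sol.q sol.qd t ⬝ᵥ w) (sol.hPID t ht)
    simp only [dotProduct_smul, dotProduct_neg, dotProduct_add, smul_eq_mul] at hP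
    have hy (w : Fin m → ℝ) : ydSig mau maa ka ku sol.q sol.qd t ⬝ᵥ w
        = ka * (yA mau maa (sol.q t ∘ Sum.inl) (sol.qd t ∘ Sum.inl) (sol.qd t ∘ Sum.inr) ⬝ᵥ w)
          + ku * (yU mau maa (sol.q t ∘ Sum.inl) (sol.qd t ∘ Sum.inl) ⬝ᵥ w) := by
      simp only [ydSig, add_dotProduct, smul_dotProduct, smul_eq_mul]
    rw [← hy, hP, hKIs.dotProduct_mulVec_comm (sol.z₁ t)]
    ring
  · have h := hKP.posSemidef.dotProduct_mulVec_nonneg (ydSig mau maa ka ku sol.q sol.qd t)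
    simpa using h
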